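/- (Key Lyapunov bound in the exponential convergence proof.) Let L be the Laplacian of a weight-balanced weighted digraph on N vertices with out-degrees dᵢ > 0, d_min = min_i dᵢ, and let Sym(L) = (L+Lᵀ)/2 have eigenvalues 0 = λ₁ ≤ λ₂ ≤ … ≤ λ_N with λ₂ > 0. Let σᵢ ∈ (0,1), σ_max = max_i σᵢ, and define 𝒜 = (1/(2λ₂)) (1 + √(λ_N σ_max/(2 d_min)))². If x̂, e ∈ ℝᴺ satisfy eᵢ² ≤ (σᵢ/(4dᵢ)) Σⱼ wᵢⱼ(x̂ᵢ − x̂ⱼ)² for all i, and x = x̂ − e, then V(x) = (1/2)‖x − (1/N)(𝟙ᴺᵀx)𝟙ᴺ‖² ≤ 𝒜 · x̂ᵀ L x̂. -/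

import Mathlib

open Matrix Finset

namespace Matrix.IsHermitian

variable {n : Type*} [Fintype n] [DecidableEq n] {S : Matrix n n ℝ}

/-- The coordinates of a vector in an orthonormal eigenbasis of a real symmetric matrix. -/
noncomputable def eigenCoord (hS : S.IsHermitian) (y : n → ℝ) (k : n) : ℝ :=
  ⇑(hS.eigenvectorBasis k) ⬝ᵥ y

lemma sum_eigenCoord_mul (hS : S.IsHermitian) (y z : n → ℝ) :
    ∑ k, hS.eigenCoord y k * hS.eigenCoord z k = y ⬝ᵥ z := by
  have h := hS.eigenvectorBasis.sum_inner_mul_inner (WithLp.toLp 2 y) (WithLp.toLp 2 z)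
  simp only [EuclideanSpace.inner_eq_star_dotProduct, star_trivial] at h
  rw [dotProduct_comm y z, ← h]
  refine Finset.sum_congr rfl fun k _ => ?_
  rw [eigenCoord, eigenCoord, dotProduct_comm _ z]

lemma eigenCoord_mulVec (hS : S.IsHermitian) (y : n → ℝ) (k : n) :
    hS.eigenCoord (S *ᵥ y) k = hS.eigenvalues k * hS.eigenCoord y k := by
  have hT : Sᵀ = S := by simpa using hS.eq
  rw [eigenCoord, dotProduct_mulVec, ← mulVec_transpose, hT, hS.mulVec_eigenvectorBasis,
    smul_dotProduct, eigenCoord, smul_eq_mul]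

lemma dotProduct_mulVec_eq_sum_eigenvalues (hS : S.IsHermitian) (y : n → ℝ) :
    y ⬝ᵥ S *ᵥ y = ∑ k, hS.eigenvalues k * hS.eigenCoord y k ^ 2 := by
  rw [← hS.sum_eigenCoord_mul]
  refine Finset.sum_congr rfl fun k _ => ?_
  rw [eigenCoord_mulVec]
  ring

lemma dotProduct_self_eq_sum_eigenCoord (hS : S.IsHermitian) (y : n → ℝ) :
    y ⬝ᵥ y = ∑ k, hS.eigenCoord y k ^ 2 := by
  simp only [← hS.sum_eigenCoord_mul, sq]

lemma dotProduct_mulVec_le (hS : S.IsHermitian) {c : ℝ} (hc : ∀ k, hS.eigenvalues k ≤ c)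
    (y : n → ℝ) : y ⬝ᵥ S *ᵥ y ≤ c * (y ⬝ᵥ y) := by
  rw [hS.dotProduct_mulVec_eq_sum_eigenvalues, hS.dotProduct_self_eq_sum_eigenCoord,
    Finset.mul_sum]
  exact Finset.sum_le_sum fun k _ => mul_le_mul_of_nonneg_right (hc k) (sq_nonneg _)

/-- Courant–Fischer lower bound on the orthogonal complement of a kernel vector `u`, when all
eigenvalues but one are at least `c > 0`. -/
lemma le_dotProduct_mulVec_of_orthogonal (hS : S.IsHermitian) {c : ℝ} (hc : 0 < c) {k₀ : n}
    (hk : ∀ k, k ≠ k₀ → c ≤ hS.eigenvalues k) {u : n → ℝ} (hu : u ≠ 0) (hSu : S *ᵥ u = 0)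
    {z : n → ℝ} (hz : u ⬝ᵥ z = 0) : c * (z ⬝ᵥ z) ≤ z ⬝ᵥ S *ᵥ z := by
  have hu0 : ∀ k, k ≠ k₀ → hS.eigenCoord u k = 0 := by
    intro k hkk
    have h := hS.eigenCoord_mulVec u k
    rw [hSu, eigenCoord, dotProduct_zero] at h
    exact (mul_eq_zero.mp h.symm).resolve_left (hc.trans_le (hk k hkk)).ne'
  have huk : hS.eigenCoord u k₀ ≠ 0 := by
    intro h
    apply hu
    rw [← dotProduct_self_eq_zero, hS.dotProduct_self_eq_sum_eigenCoord]
    refine Finset.sum_eq_zero fun k _ => ?_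
    by_cases hkk : k = k₀
    · rw [hkk, h, zero_pow two_ne_zero]
    · rw [hu0 k hkk, zero_pow two_ne_zero]
  have hzk : hS.eigenCoord z k₀ = 0 := by
    rw [← hS.sum_eigenCoord_mul, Finset.sum_eq_single k₀] at hz
    · exact (mul_eq_zero.mp hz).resolve_left huk
    · intro k _ hkk
      rw [hu0 k hkk, zero_mul]
    · simp
  rw [hS.dotProduct_mulVec_eq_sum_eigenvalues, hS.dotProduct_self_eq_sum_eigenCoord,
    Finset.mul_sum]
  refine Finset.sum_le_sum fun k _ => ?_
  by_cases hkk : k = k₀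
  · simp [hkk, hzk]
  · exact mul_le_mul_of_nonneg_right (hk k hkk) (sq_nonneg _)

end Matrix.IsHermitian

namespace Matrix

variable {n : Type*} [Fintype n]

lemma dotProduct_symmetrization_mulVec (A : Matrix n n ℝ) (y : n → ℝ) :
    y ⬝ᵥ ((1 / 2 : ℝ) • (A + Aᵀ)) *ᵥ y = y ⬝ᵥ A *ᵥ y := by
  have h : y ⬝ᵥ Aᵀ *ᵥ y = y ⬝ᵥ A *ᵥ y := by
    rw [mulVec_transpose, dotProduct_comm, dotProduct_mulVec]
  rw [smul_mulVec, add_mulVec, dotProduct_smul, dotProduct_add, h, smul_eq_mul]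
  ring

/-- The Laplacian quadratic form of a weight-balanced digraph as a sum over edges. -/
lemma dotProduct_laplacian_mulVec [DecidableEq n] {W : Matrix n n ℝ}
    (hbal : ∀ i, ∑ j, W i j = ∑ j, W j i) (y : n → ℝ) :
    y ⬝ᵥ (diagonal (fun i => ∑ k, W i k) - W) *ᵥ y
      = 1 / 2 * ∑ i, ∑ j, W i j * (y i - y j) ^ 2 := by
  have hlhs : y ⬝ᵥ (diagonal (fun i => ∑ k, W i k) - W) *ᵥ y
      = ∑ i, (∑ j, W i j) * y i ^ 2 - ∑ i, ∑ j, W i j * (y i * y j) := by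
    rw [sub_mulVec, dotProduct_sub]
    congr 1
    · simp only [dotProduct, mulVec_diagonal]
      exact Finset.sum_congr rfl fun i _ => by ring
    · simp only [dotProduct, mulVec, Finset.mul_sum]
      exact Finset.sum_congr rfl fun i _ => Finset.sum_congr rfl fun j _ => by ring
  have hin : ∑ i, ∑ j, W i j * y j ^ 2 = ∑ i, (∑ j, W i j) * y i ^ 2 := by
    rw [Finset.sum_comm]
    exact Finset.sum_congr rfl fun i _ => by rw [hbal i, Finset.sum_mul]
  have hrhs : ∑ i, ∑ j, W i j * (y i - y j) ^ 2
      = ∑ i, (∑ j, W i j) * y i ^ 2 + ∑ i, ∑ j, W i j * y j ^ 2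
        - 2 * ∑ i, ∑ j, W i j * (y i * y j) := by
    simp only [Finset.sum_mul, Finset.mul_sum, ← Finset.sum_add_distrib,
      ← Finset.sum_sub_distrib]
    exact Finset.sum_congr rfl fun i _ => Finset.sum_congr rfl fun j _ => by ring
  rw [hlhs, hrhs, hin]
  ring

lemma symmetrized_laplacian_mulVec_one [DecidableEq n] {W : Matrix n n ℝ}
    (hbal : ∀ i, ∑ j, W i j = ∑ j, W j i) :
    ((1 / 2 : ℝ) • ((diagonal (fun i => ∑ k, W i k) - W)
      + (diagonal (fun i => ∑ k, W i k) - W)ᵀ)) *ᵥ (1 : n → ℝ) = 0 := by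
  ext i
  rw [smul_mulVec, add_mulVec, transpose_sub, diagonal_transpose, sub_mulVec, sub_mulVec]
  simp only [Pi.smul_apply, Pi.add_apply, Pi.sub_apply, mulVec_diagonal]
  simp [mulVec, dotProduct, ← hbal i]

end Matrix

/-- A weighted form of the triangle inequality for the edge seminorm. -/
lemma sum_weighted_sq_sub_le {n : Type*} [Fintype n] {W : Matrix n n ℝ}
    (hW : ∀ i j, 0 ≤ W i j) {s : ℝ} (hs : 0 < s) (y z : n → ℝ)
    (h : ∑ i, ∑ j, W i j * (z i - z j) ^ 2 ≤ s ^ 2 * ∑ i, ∑ j, W i j * (y i - y j) ^ 2) :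
    ∑ i, ∑ j, W i j * ((y i - z i) - (y j - z j)) ^ 2
      ≤ (1 + s) ^ 2 * ∑ i, ∑ j, W i j * (y i - y j) ^ 2 := by
  have key : s * ∑ i, ∑ j, W i j * ((y i - z i) - (y j - z j)) ^ 2
      ≤ s * (1 + s) * ∑ i, ∑ j, W i j * (y i - y j) ^ 2
        + (1 + s) * ∑ i, ∑ j, W i j * (z i - z j) ^ 2 := by
    simp only [Finset.mul_sum, ← Finset.sum_add_distrib]
    refine Finset.sum_le_sum fun i _ => Finset.sum_le_sum fun j _ => ?_
    linarith [mul_nonneg (hW i j) (sq_nonneg (s * (y i - y j) + (z i - z j)))]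
  refine le_of_mul_le_mul_left (key.trans ?_) hs
  linarith [mul_le_mul_of_nonneg_left h (by positivity : 0 ≤ 1 + s)]

/-- key Lyapunov bound in the exponential convergence proof:
for a weight-balanced digraph with Laplacian `L`, out-degrees `dᵢ > 0`, `d_min = minᵢ dᵢ`,
eigenvalues `0 = λ₁ ≤ λ₂ ≤ … ≤ λ_N` of `Sym(L) = (L + Lᵀ)/2` with `λ₂ > 0`
(here `μ` is a monotone enumeration of the eigenvalues up to a permutation `π`),
`σᵢ ∈ (0,1)`, `σ_max = maxᵢ σᵢ`, and
`𝒜 = (1/(2λ₂))(1 + √(λ_N σ_max/(2 d_min)))²`: if `eᵢ² ≤ (σᵢ/(4dᵢ)) ∑ⱼ wᵢⱼ(x̂ᵢ - x̂ⱼ)²`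
for all `i` and `x = x̂ - e`, then
`V(x) = (1/2)‖x - (1/N)(𝟙ᵀx)𝟙‖² ≤ 𝒜 x̂ᵀ L x̂`. -/
theorem lyapunov_bound_by_laplacian_quadratic
    (N : ℕ) (hN : 1 < N) (W : Matrix (Fin N) (Fin N) ℝ)
    (hWnn : ∀ i j, 0 ≤ W i j) (hWdiag : ∀ i, W i i = 0)
    (hbal : ∀ i, ∑ j, W i j = ∑ j, W j i)
    (hd : ∀ i, 0 < ∑ j, W i j)
    (L : Matrix (Fin N) (Fin N) ℝ)
    (hL : L = Matrix.diagonal (fun i => ∑ k, W i k) - W)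
    (S : Matrix (Fin N) (Fin N) ℝ) (hS : S = (1/2 : ℝ) • (L + Lᵀ))
    (hherm : S.IsHermitian)
    (μ : Fin N → ℝ) (hmono : Monotone μ) (π : Equiv.Perm (Fin N))
    (hμ : ∀ k, μ k = hherm.eigenvalues (π k))
    (hμ0 : μ ⟨0, by omega⟩ = 0)
    (hlam2 : 0 < μ ⟨1, hN⟩)
    (σ : Fin N → ℝ) (hσ : ∀ i, σ i ∈ Set.Ioo (0 : ℝ) 1)
    (dmin σmax 𝒜 : ℝ)
    (hdmin : dmin = Finset.univ.inf' ⟨⟨0, by omega⟩, Finset.mem_univ _⟩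
      (fun i => ∑ j, W i j))
    (hσmax : σmax = Finset.univ.sup' ⟨⟨0, by omega⟩, Finset.mem_univ _⟩ σ)
    (hA : 𝒜 = 1 / (2 * μ ⟨1, hN⟩) *
      (1 + Real.sqrt (μ ⟨N - 1, by omega⟩ * σmax / (2 * dmin)))^2)
    (xhat e x : Fin N → ℝ)
    (htrig : ∀ i, (e i)^2 ≤
      σ i / (4 * ∑ j, W i j) * ∑ j, W i j * (xhat i - xhat j)^2)
    (hx : ∀ i, x i = xhat i - e i) :
    (1/2) * ∑ i, (x i - (1 / (N : ℝ)) * ∑ j, x j)^2 ≤ 𝒜 * (xhat ⬝ᵥ L.mulVec xhat) := by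
  have hdmin_le : ∀ i, dmin ≤ ∑ j, W i j := fun i => by
    rw [hdmin]
    exact Finset.inf'_le (fun i => ∑ j, W i j) (Finset.mem_univ i)
  have hdmin_pos : 0 < dmin := by
    rw [hdmin]
    exact (Finset.lt_inf'_iff _).mpr fun i _ => hd i
  have hσ_le : ∀ i, σ i ≤ σmax := fun i => by
    rw [hσmax]
    exact Finset.le_sup' σ (Finset.mem_univ i)
  have hσmax_pos : 0 < σmax := (hσ ⟨0, by omega⟩).1.trans_le (hσ_le _)
  have hquad : ∀ y : Fin N → ℝ, y ⬝ᵥ S *ᵥ y = 1 / 2 * ∑ i, ∑ j, W i j * (y i - y j) ^ 2 :=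
    fun y => by
      rw [hS, dotProduct_symmetrization_mulVec, hL, dotProduct_laplacian_mulVec hbal]
  have hμN_pos : 0 < μ ⟨N - 1, by omega⟩ :=
    hlam2.trans_le (hmono (Fin.mk_le_mk.mpr (by omega)))
  have hupper : ∀ k, hherm.eigenvalues k ≤ μ ⟨N - 1, by omega⟩ := fun k => by
    rw [← π.apply_symm_apply k, ← hμ]
    exact hmono (Fin.mk_le_mk.mpr (by omega))
  have hlower : ∀ k, k ≠ π ⟨0, by omega⟩ → μ ⟨1, hN⟩ ≤ hherm.eigenvalues k := fun k hk => by
    rw [← π.apply_symm_apply k, ← hμ]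
    apply hmono
    have hne : (π.symm k).val ≠ 0 := fun h =>
      hk (by rw [← π.apply_symm_apply k]; exact congrArg π (Fin.ext h))
    exact Fin.le_def.mpr (Nat.one_le_iff_ne_zero.mpr hne)
  have hN0 : (N : ℝ) ≠ 0 := by positivity
  set s := Real.sqrt (μ ⟨N - 1, by omega⟩ * σmax / (2 * dmin))
  have hs_pos : 0 < s := Real.sqrt_pos.mpr (by positivity)
  have hs_sq : s ^ 2 = μ ⟨N - 1, by omega⟩ * σmax / (2 * dmin) := Real.sq_sqrt (by positivity)
  have he : e ⬝ᵥ e ≤ σmax / (4 * dmin) * ∑ i, ∑ j, W i j * (xhat i - xhat j) ^ 2 := by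
    rw [dotProduct, Finset.mul_sum]
    refine Finset.sum_le_sum fun i _ => ?_
    rw [← sq]
    refine (htrig i).trans (mul_le_mul_of_nonneg_right ?_ ?_)
    · exact div_le_div₀ hσmax_pos.le (hσ_le i) (by positivity) (by linarith [hdmin_le i])
    · exact Finset.sum_nonneg fun j _ => mul_nonneg (hWnn i j) (sq_nonneg _)
  have herr : ∑ i, ∑ j, W i j * (e i - e j) ^ 2
      ≤ s ^ 2 * ∑ i, ∑ j, W i j * (xhat i - xhat j) ^ 2 := by
    have h1 := hherm.dotProduct_mulVec_le hupper e
    rw [hquad] at h1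
    have h2 := mul_le_mul_of_nonneg_left he hμN_pos.le
    calc _ ≤ 2 * (μ ⟨N - 1, by omega⟩ *
          (σmax / (4 * dmin) * ∑ i, ∑ j, W i j * (xhat i - xhat j) ^ 2)) := by linarith
      _ = _ := by
        rw [hs_sq]
        field_simp
        ring
  have htri := sum_weighted_sq_sub_le hWnn hs_pos xhat e herr
  have hdis : μ ⟨1, hN⟩ * ∑ i, (x i - (1 / (N : ℝ)) * ∑ j, x j) ^ 2
      ≤ 1 / 2 * ∑ i, ∑ j, W i j * ((xhat i - e i) - (xhat j - e j)) ^ 2 := by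
    have h := hherm.le_dotProduct_mulVec_of_orthogonal hlam2 hlower (u := 1)
      (fun h => one_ne_zero (congrFun h ⟨0, by omega⟩))
      (by rw [hS, hL, symmetrized_laplacian_mulVec_one hbal])
      (z := fun i => x i - (1 / (N : ℝ)) * ∑ j, x j)
      (by
        simp only [dotProduct, Pi.one_apply, one_mul, Finset.sum_sub_distrib, Finset.sum_const,
          Finset.card_univ, Fintype.card_fin, nsmul_eq_mul]
        field_simp
        ring)
    rw [hquad] at h
    simpa only [dotProduct, ← sq, sub_sub_sub_cancel_right, hx] using h
  have hL_quad : xhat ⬝ᵥ L *ᵥ xhat = 1 / 2 * ∑ i, ∑ j, W i j * (xhat i - xhat j) ^ 2 := by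
    rw [hL, dotProduct_laplacian_mulVec hbal]
  rw [hL_quad, hA]
  refine le_of_mul_le_mul_left ?_ hlam2
  calc _ ≤ 1 / 2 * (1 / 2 * ((1 + s) ^ 2 * ∑ i, ∑ j, W i j * (xhat i - xhat j) ^ 2)) := by
        linarith
    _ = _ := by field_simp
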